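/- arXiv:2310.15963 — 4 statements merged into one kernel-verified Lean document; each statement's English description precedes it below -/
import Mathlib

section
/- Second singular integral formula (Steps 2–4 of Lemma 3.1, equation (3.10)). Let α ∈ (0,2). For every j ∈ ℤ one has (1/2π)·∫_{−π}^{π} e^{−ijz}·(2(1 − cos z))^{1−α/2} dz = −(2−α)·M_α(|j|), where the integrand is Lebesgue integrable on (−π,π). -/
open Real MeasureTheory

/-- `M_α(n) := (Γ(2−α)/(Γ(1−α/2)·Γ(α/2)))·Γ(α/2+n)/((n² − (1−α/2)²)·Γ(1−α/2+n))`. -/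
noncomputable def Msymb (α : ℝ) (n : ℕ) : ℝ :=
  (Real.Gamma (2 - α) / (Real.Gamma (1 - α / 2) * Real.Gamma (α / 2))) *
    (Real.Gamma (α / 2 + n) /
      (((n : ℝ) ^ 2 - (1 - α / 2) ^ 2) * Real.Gamma (1 - α / 2 + n)))

/-- The weight `(2(1 − cos z))^a` is continuous for `0 < a`. -/
lemma continuous_two_mul_one_sub_cos_rpow {a : ℝ} (ha : 0 < a) :
    Continuous fun z : ℝ => (2 * (1 - Real.cos z)) ^ a :=
  Continuous.rpow_const (by fun_prop) fun _ => Or.inr ha.le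

/-- Integration by parts: the recurrence between consecutive cosine coefficients of
`(2(1 − cos z))^a`. -/
lemma integral_cos_mul_rpow_succ {a : ℝ} (ha : 0 < a) (n : ℕ) :
    ((n : ℝ) + 1 + a) *
        ∫ z in (0 : ℝ)..π, Real.cos ((n + 1) * z) * (2 * (1 - Real.cos z)) ^ a
      = ((n : ℝ) - a) * ∫ z in (0 : ℝ)..π, Real.cos (n * z) * (2 * (1 - Real.cos z)) ^ a := by
  have hw := continuous_two_mul_one_sub_cos_rpow ha
  have hintble : ∀ c : ℝ, IntervalIntegrable
      (fun z : ℝ => Real.cos (c * z) * (2 * (1 - Real.cos z)) ^ a) volume 0 π := fun c =>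
    Continuous.intervalIntegrable (by fun_prop) _ _
  have hderiv : ∀ x ∈ Set.Ioo (0 : ℝ) π, HasDerivAt
      (fun z : ℝ => (2 * (1 - Real.cos z)) ^ a * (Real.sin ((n + 1) * z) - Real.sin (n * z)))
      (((n : ℝ) + 1 + a) * (Real.cos ((n + 1) * x) * (2 * (1 - Real.cos x)) ^ a) -
        ((n : ℝ) - a) * (Real.cos (n * x) * (2 * (1 - Real.cos x)) ^ a)) x := by
    intro x hx
    have hs : 0 < Real.sin x := Real.sin_pos_of_mem_Ioo hx
    have hc : 0 < 1 - Real.cos x := by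
      nlinarith [Real.sin_sq_add_cos_sq x, Real.cos_le_one x, Real.neg_one_le_cos x]
    have hb : HasDerivAt (fun z : ℝ => 2 * (1 - Real.cos z)) (2 * Real.sin x) x := by
      simpa using ((Real.hasDerivAt_cos x).const_sub 1).const_mul 2
    have hsin : ∀ c : ℝ, HasDerivAt (fun z : ℝ => Real.sin (c * z)) (Real.cos (c * x) * c) x :=
      fun c => by simpa using (((hasDerivAt_id x).const_mul c).sin)
    have h := (hb.rpow_const (p := a) (Or.inl (by positivity))).mul
      ((hsin (n + 1)).sub (hsin n))
    refine h.congr_deriv ?_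
    have hpow : (2 * (1 - Real.cos x)) ^ (a - 1) = (2 * (1 - Real.cos x)) ^ a /
        (2 * (1 - Real.cos x)) := Real.rpow_sub_one (by positivity) a
    simp only [Pi.sub_apply]
    rw [hpow]
    have e : ((n : ℝ) + 1) * x = n * x + x := by ring
    rw [e, Real.sin_add, Real.cos_add]
    field_simp
    have h2 : Real.sin x ^ 2 = 1 - Real.cos x ^ 2 := by
      linarith [Real.sin_sq_add_cos_sq x]
    ring_nf
    simp only [h2]
    ring
  have key := intervalIntegral.integral_eq_sub_of_hasDerivAt_of_le Real.pi_pos.le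
    (Continuous.continuousOn (by fun_prop)) hderiv
    (((hintble _).const_mul _).sub ((hintble _).const_mul _))
  rw [intervalIntegral.integral_sub ((hintble _).const_mul _) ((hintble _).const_mul _),
    intervalIntegral.integral_const_mul, intervalIntegral.integral_const_mul] at key
  have h1 : Real.sin (((n : ℝ) + 1) * π) = 0 := by exact_mod_cast Real.sin_nat_mul_pi (n + 1)
  simp only [h1, Real.sin_nat_mul_pi, mul_zero, Real.sin_zero, sub_zero] at key
  linarith

/-- The substitution `x = (1 − cos z)/2` in Euler's Beta integral. -/
lemma integral_one_sub_cos_rpow {a : ℝ} (ha : 0 < a) :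
    ∫ z in (0 : ℝ)..π, ((1 - Real.cos z) / 2) ^ a =
      Real.Gamma (a + 1 / 2) * Real.Gamma (1 / 2) / Real.Gamma (a + 1) := by
  have himg : (fun z : ℝ => (1 - Real.cos z) / 2) '' Set.Ioo 0 π = Set.Ioo 0 1 := by
    ext x
    constructor
    · rintro ⟨z, hz, rfl⟩
      have hs : 0 < Real.sin z := Real.sin_pos_of_mem_Ioo hz
      constructor <;>
        nlinarith [Real.sin_sq_add_cos_sq z, Real.cos_le_one z, Real.neg_one_le_cos z]
    · rintro ⟨h0, h1⟩
      refine ⟨Real.arccos (1 - 2 * x), ⟨Real.arccos_pos.2 (by linarith), ?_⟩, ?_⟩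
      · exact lt_of_le_of_ne (Real.arccos_le_pi _) fun h => by
          have := Real.arccos_eq_pi.1 h
          linarith
      · simp only
        rw [Real.cos_arccos (by linarith) (by linarith)]
        ring
  have hinj : Set.InjOn (fun z : ℝ => (1 - Real.cos z) / 2) (Set.Ioo 0 π) := fun x hx y hy h =>
    Real.injOn_cos (Set.Ioo_subset_Icc_self hx) (Set.Ioo_subset_Icc_self hy) (by
      simp only at h
      linarith)
  have hsub := integral_image_eq_integral_abs_deriv_smul (f' := fun z => Real.sin z / 2)
    (measurableSet_Ioo (a := (0 : ℝ)) (b := π))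
    (fun x _ => by
      simpa using (((Real.hasDerivAt_cos x).const_sub 1).div_const 2).hasDerivWithinAt)
    hinj (fun x : ℝ => x ^ (a + 1 / 2 - 1) * (1 - x) ^ ((1 : ℝ) / 2 - 1))
  rw [himg] at hsub
  have hbeta : ((∫ x in Set.Ioo (0 : ℝ) 1,
      x ^ (a + 1 / 2 - 1) * (1 - x) ^ ((1 : ℝ) / 2 - 1) : ℝ) : ℂ) =
      Complex.betaIntegral ((a + 1 / 2 : ℝ) : ℂ) ((1 / 2 : ℝ) : ℂ) := by
    rw [Complex.betaIntegral, intervalIntegral.integral_of_le zero_le_one,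
      integral_Ioc_eq_integral_Ioo, ← integral_complex_ofReal]
    refine setIntegral_congr_fun measurableSet_Ioo fun x hx => ?_
    rw [Complex.ofReal_mul, Complex.ofReal_cpow hx.1.le, Complex.ofReal_cpow (by linarith [hx.2])]
    push_cast
    rfl
  rw [Complex.betaIntegral_eq_Gamma_mul_div _ _ (by rw [Complex.ofReal_re]; positivity)
    (by rw [Complex.ofReal_re]; positivity), ← Complex.ofReal_add, Complex.Gamma_ofReal,
    Complex.Gamma_ofReal, Complex.Gamma_ofReal] at hbeta
  have hbeta' : ∫ x in Set.Ioo (0 : ℝ) 1, x ^ (a + 1 / 2 - 1) * (1 - x) ^ ((1 : ℝ) / 2 - 1) =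
      Real.Gamma (a + 1 / 2) * Real.Gamma (1 / 2) / Real.Gamma (a + 1 / 2 + 1 / 2) := by
    exact_mod_cast hbeta
  rw [intervalIntegral.integral_of_le Real.pi_pos.le, integral_Ioc_eq_integral_Ioo,
    show a + 1 = a + 1 / 2 + 1 / 2 by ring, ← hbeta', hsub]
  refine setIntegral_congr_fun measurableSet_Ioo fun z hz => ?_
  have hx : (1 - Real.cos z) / 2 ∈ Set.Ioo (0 : ℝ) 1 := himg ▸ Set.mem_image_of_mem _ hz
  have hs : 0 < Real.sin z := Real.sin_pos_of_mem_Ioo hz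
  simp only [smul_eq_mul]
  set x := (1 - Real.cos z) / 2 with hxdef
  have hx1 : 0 < 1 - x := by linarith [hx.2]
  have hsx : |Real.sin z / 2| = x ^ ((1 : ℝ) / 2) * (1 - x) ^ ((1 : ℝ) / 2) := by
    rw [← Real.sqrt_eq_rpow, ← Real.sqrt_eq_rpow, ← Real.sqrt_mul hx.1.le, ← Real.sqrt_sq_eq_abs]
    congr 1
    rw [hxdef]
    nlinarith [Real.sin_sq_add_cos_sq z]
  rw [hsx, show x ^ ((1 : ℝ) / 2) * (1 - x) ^ ((1 : ℝ) / 2) *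
      (x ^ (a + 1 / 2 - 1) * (1 - x) ^ ((1 : ℝ) / 2 - 1)) =
      (x ^ ((1 : ℝ) / 2) * x ^ (a + 1 / 2 - 1)) *
        ((1 - x) ^ ((1 : ℝ) / 2) * (1 - x) ^ ((1 : ℝ) / 2 - 1)) by ring,
    ← Real.rpow_add hx.1, ← Real.rpow_add hx1]
  norm_num
  congr 1
  ring

/-- The integral of `(2(1 − cos z))^a` over `(0,π)`. -/
lemma integral_two_mul_one_sub_cos_rpow {a : ℝ} (ha : 0 < a) :
    ∫ z in (0 : ℝ)..π, (2 * (1 - Real.cos z)) ^ a =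
      π * Real.Gamma (2 * a + 1) / Real.Gamma (a + 1) ^ 2 := by
  have h4 : ∀ z : ℝ, (2 * (1 - Real.cos z)) ^ a = 4 ^ a * ((1 - Real.cos z) / 2) ^ a := fun z => by
    rw [← Real.mul_rpow (by norm_num) (by linarith [Real.cos_le_one z])]
    congr 1
    ring
  simp only [h4]
  rw [intervalIntegral.integral_const_mul, integral_one_sub_cos_rpow ha, Real.Gamma_one_half_eq]
  have hd := Real.Gamma_mul_Gamma_add_half (a + 1 / 2)
  rw [show a + 1 / 2 + 1 / 2 = a + 1 by ring, show 2 * (a + 1 / 2) = 2 * a + 1 by ring,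
    show 1 - (2 * a + 1) = -(2 * a) by ring, Real.rpow_neg (by norm_num), Real.rpow_mul (by norm_num),
    show (2 : ℝ) ^ (2 : ℝ) = 4 by norm_num] at hd
  have hG : 0 < Real.Gamma (a + 1) := Real.Gamma_pos_of_pos (by linarith)
  have h4a : (0 : ℝ) < 4 ^ a := by positivity
  have hpi : √π * √π = π := Real.mul_self_sqrt Real.pi_pos.le
  rw [eq_div_iff (by positivity)]
  have hd' : Real.Gamma (a + 1 / 2) * Real.Gamma (a + 1) * 4 ^ a =
      Real.Gamma (2 * a + 1) * √π := by
    rw [hd]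
    field_simp
  calc _ = Real.Gamma (a + 1 / 2) * Real.Gamma (a + 1) * 4 ^ a * √π := by
        rw [sq, mul_assoc, ← mul_assoc (_ / _), div_mul_cancel₀ _ hG.ne']
        ring
    _ = _ := by linear_combination √π * hd' + Real.Gamma (2 * a + 1) * hpi

/-- Cosine coefficients of `(2(1 − cos z))^(1 − α/2)`. -/
lemma integral_cos_mul_rpow_eq_Msymb {α : ℝ} (hα : α ∈ Set.Ioo (0 : ℝ) 2) (n : ℕ) :
    ∫ z in (0 : ℝ)..π, Real.cos (n * z) * (2 * (1 - Real.cos z)) ^ (1 - α / 2) =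
      π * (-(2 - α) * Msymb α n) := by
  obtain ⟨a, rfl⟩ : ∃ a, α = 2 - 2 * a := ⟨1 - α / 2, by ring⟩
  have ha : 0 < a := by linarith [hα.2]
  have ha1 : a < 1 := by linarith [hα.1]
  have e2 : 2 - (2 - 2 * a) = 2 * a := by ring
  have e3 : (2 - 2 * a) / 2 = 1 - a := by ring
  have hGa := Real.Gamma_pos_of_pos ha
  have hGb := Real.Gamma_pos_of_pos (sub_pos.2 ha1)
  have e4 : 1 - (1 - a) = a := by ring
  simp only [Msymb, e2, e3, e4]
  induction n with
  | zero =>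
    simp only [Nat.cast_zero, zero_mul, Real.cos_zero, one_mul, add_zero]
    rw [integral_two_mul_one_sub_cos_rpow ha, Real.Gamma_add_one ha.ne',
      Real.Gamma_add_one (by positivity)]
    field_simp
    ring
  | succ n ih =>
    have hrec := integral_cos_mul_rpow_succ ha n
    rw [ih] at hrec
    have hn : (0 : ℝ) ≤ n := n.cast_nonneg
    have hp : (n : ℝ) + 1 + a ≠ 0 := by positivity
    have hna : (n : ℝ) - a ≠ 0 := by
      rcases Nat.eq_zero_or_pos n with rfl | h
      · simpa using ha.ne'
      · have : (1 : ℝ) ≤ n := by exact_mod_cast h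
        linarith
    have hG2 : Real.Gamma (a + n) ≠ 0 := (Real.Gamma_pos_of_pos (by positivity)).ne'
    have hq : (n : ℝ) + 1 - a ≠ 0 := by linarith
    have hs : a + (n : ℝ) ≠ 0 := by positivity
    have f1 : ((n : ℝ) ^ 2 - a ^ 2) = (n - a) * (a + n) := by ring
    have f2 : (((n : ℝ) + 1) ^ 2 - a ^ 2) = (n + 1 - a) * (n + 1 + a) := by ring
    push_cast
    rw [← mul_right_inj' hp, hrec, f1, f2, ← add_assoc, ← add_assoc,
      Real.Gamma_add_one (s := a + n) hs,
      Real.Gamma_add_one (s := 1 - a + n) (by linarith)]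
    rw [show 1 - a + (n : ℝ) = n + 1 - a by ring]
    field_simp

/-- Second singular integral formula (Steps 2–4 of Lemma 3.1, equation (3.10)):
for `α ∈ (0,2)` and `j ∈ ℤ`,
`(1/2π)·∫_{−π}^{π} e^{−ijz}·(2(1 − cos z))^{1−α/2} dz = −(2−α)·M_α(|j|)`,
the integrand being Lebesgue integrable on `(−π,π)`. -/
theorem second_singular_integral (α : ℝ) (hα : α ∈ Set.Ioo (0 : ℝ) 2) (j : ℤ) :
    IntervalIntegrable
        (fun z : ℝ => Complex.exp (-Complex.I * j * z) *
          (((2 * (1 - Real.cos z)) ^ (1 - α / 2) : ℝ) : ℂ))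
        volume (-π) π ∧
    (1 / (2 * (π : ℂ))) *
        ∫ z in (-π)..π, Complex.exp (-Complex.I * j * z) *
          (((2 * (1 - Real.cos z)) ^ (1 - α / 2) : ℝ) : ℂ)
      = ((-(2 - α) * Msymb α j.natAbs : ℝ) : ℂ) := by
  have ha : 0 < 1 - α / 2 := by linarith [hα.2]
  have hw := continuous_two_mul_one_sub_cos_rpow ha
  have hcont : Continuous (fun z : ℝ => Complex.exp (-Complex.I * j * z) *
      (((2 * (1 - Real.cos z)) ^ (1 - α / 2) : ℝ) : ℂ)) := by fun_prop
  refine ⟨hcont.intervalIntegrable _ _, ?_⟩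
  rw [← intervalIntegral.integral_add_adjacent_intervals (b := 0)
    (hcont.intervalIntegrable _ _) (hcont.intervalIntegrable _ _)]
  have hneg := intervalIntegral.integral_comp_neg (a := 0) (b := π)
    (fun z : ℝ => Complex.exp (-Complex.I * j * z) *
      (((2 * (1 - Real.cos z)) ^ (1 - α / 2) : ℝ) : ℂ))
  rw [neg_zero] at hneg
  have hcont_neg : Continuous (fun z : ℝ => Complex.exp (-Complex.I * j * ((-z : ℝ) : ℂ)) *
      (((2 * (1 - Real.cos (-z))) ^ (1 - α / 2) : ℝ) : ℂ)) := hcont.comp continuous_neg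
  rw [← hneg, ← intervalIntegral.integral_add (hcont_neg.intervalIntegrable _ _)
    (hcont.intervalIntegrable _ _)]
  have hpt : ∀ z : ℝ, Complex.exp (-Complex.I * j * ((-z : ℝ) : ℂ)) *
      (((2 * (1 - Real.cos (-z))) ^ (1 - α / 2) : ℝ) : ℂ) +
      Complex.exp (-Complex.I * j * z) * (((2 * (1 - Real.cos z)) ^ (1 - α / 2) : ℝ) : ℂ) =
      ((2 * (Real.cos (j.natAbs * z) * (2 * (1 - Real.cos z)) ^ (1 - α / 2)) : ℝ) : ℂ) := by
    intro z
    have hc : Real.cos (j.natAbs * z) = Real.cos (j * z) := by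
      rcases Int.natAbs_eq j with h | h
      · have : (j : ℝ) = j.natAbs := by
          simpa only [Int.cast_natCast] using congrArg (Int.cast : ℤ → ℝ) h
        rw [this]
      · have : (j : ℝ) = -j.natAbs := by
          simpa only [Int.cast_neg, Int.cast_natCast] using congrArg (Int.cast : ℤ → ℝ) h
        rw [this, neg_mul, Real.cos_neg]
    rw [hc, Real.cos_neg, ← add_mul, ← mul_assoc, Complex.ofReal_mul]
    congr 1
    push_cast
    rw [Complex.two_cos]
    ring_nf
  simp only [hpt]
  rw [intervalIntegral.integral_ofReal, intervalIntegral.integral_const_mul,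
    integral_cos_mul_rpow_eq_Msymb hα]
  have hpi : (π : ℂ) ≠ 0 := Complex.ofReal_ne_zero.2 Real.pi_ne_zero
  push_cast
  field_simp
end

section
/- Sine-multiplier singular integral formula (Lemma 4.4, Fourier form). Let α ∈ (0,2). For every j ∈ ℤ, the function z ↦ e^{−ijz}·sin z·(2(1 − cos z))^{−α/2} (defined for z ∈ (−π,π)∖{0}) is Lebesgue integrable on (−π,π) and (1/2π)·∫_{−π}^{π} e^{−ijz}·sin z·(2(1 − cos z))^{−α/2} dz = −i·j·M_α(|j|). -/
open Real MeasureTheory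

/-- The function `z ↦ (2(1 − cos z))^b`. -/
noncomputable def chordPow (b z : ℝ) : ℝ := (2 * (1 - Real.cos z)) ^ b

/-- The unnormalised `j`-th Fourier coefficient of `z ↦ (2(1 − cos z))^b` on `(−π,π)`. -/
noncomputable def chordFourier (b : ℝ) (j : ℤ) : ℂ :=
  ∫ z in (-π)..π, Complex.exp (-Complex.I * j * z) * (chordPow b z : ℂ)

lemma continuous_chordPow {b : ℝ} (hb : 0 < b) : Continuous (chordPow b) :=
  (continuous_const.mul (continuous_const.sub Real.continuous_cos)).rpow_const
    fun _ => Or.inr hb.le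

lemma chordPow_neg (b z : ℝ) : chordPow b (-z) = chordPow b z := by simp [chordPow]

lemma chordPow_eq_mul_sub_one {b z : ℝ} (hz : 0 < 1 - Real.cos z) :
    chordPow b z = 2 * (1 - Real.cos z) * chordPow (b - 1) z := by
  rw [chordPow, chordPow, Real.rpow_sub_one (by positivity)]
  field_simp

lemma one_sub_cos_pos {z : ℝ} (hz : z ∈ Set.Ioo (-π) π) (h0 : z ≠ 0) :
    0 < 1 - Real.cos z := by
  have hle := Real.cos_le_one z
  rcases hle.lt_or_eq with h | h
  · linarith
  · exact absurd ((Real.cos_eq_one_iff_of_lt_of_lt (by linarith [hz.1, Real.pi_pos])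
      (by linarith [hz.2, Real.pi_pos])).1 h) h0

lemma hasDerivAt_chordPow (b : ℝ) {z : ℝ} (hz : 0 < 1 - Real.cos z) :
    HasDerivAt (chordPow b) (2 * b * (Real.sin z * chordPow (b - 1) z)) z := by
  have h : HasDerivAt (chordPow b) _ z :=
    (((Real.hasDerivAt_cos z).const_sub 1).const_mul 2).rpow_const (Or.inl (by positivity))
  convert h using 1
  rw [chordPow]
  ring

lemma intervalIntegrable_sin_mul_chordPow {b : ℝ} (hb : 0 < b) :
    IntervalIntegrable (fun z => Real.sin z * chordPow (b - 1) z) volume (-π) π := by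
  have hpi := Real.pi_pos
  have h1 : IntervalIntegrable (fun z => 2 * b * (Real.sin z * chordPow (b - 1) z))
      volume 0 π := by
    apply intervalIntegral.intervalIntegrable_deriv_of_nonneg
      (continuous_chordPow hb).continuousOn
    · intro z hz
      rw [min_eq_left hpi.le, max_eq_right hpi.le] at hz
      exact hasDerivAt_chordPow b (one_sub_cos_pos ⟨by linarith [hz.1], hz.2⟩ hz.1.ne')
    · intro z hz
      rw [min_eq_left hpi.le, max_eq_right hpi.le] at hz
      have := Real.sin_nonneg_of_nonneg_of_le_pi hz.1.le hz.2.le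
      have : 0 ≤ chordPow (b - 1) z :=
        Real.rpow_nonneg (by linarith [Real.cos_le_one z]) _
      positivity
  have h2 : IntervalIntegrable (fun z => Real.sin z * chordPow (b - 1) z) volume 0 π := by
    convert h1.const_mul (2 * b)⁻¹ using 2 with z
    field_simp
  refine IntervalIntegrable.trans (b := 0) ?_ h2
  have h3 := (IntervalIntegrable.iff_comp_neg enorm_ne_top).1 h2.neg
  simp only [Pi.neg_apply, Real.sin_neg, chordPow_neg, neg_mul, neg_neg, neg_zero] at h3
  exact h3.symm

lemma continuous_fourierExp (j : ℤ) :
    Continuous fun z : ℝ => Complex.exp (-Complex.I * j * z) := by fun_prop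

lemma intervalIntegrable_exp_mul_sin_mul_chordPow {b : ℝ} (hb : 0 < b) (j : ℤ) :
    IntervalIntegrable (fun z : ℝ => Complex.exp (-Complex.I * j * z) * (Real.sin z : ℂ) *
      (chordPow (b - 1) z : ℂ)) volume (-π) π := by
  have h : IntervalIntegrable (fun z : ℝ => ((Real.sin z * chordPow (b - 1) z : ℝ) : ℂ))
      volume (-π) π :=
    ⟨(intervalIntegrable_sin_mul_chordPow hb).1.ofReal,
      (intervalIntegrable_sin_mul_chordPow hb).2.ofReal⟩
  convert h.continuousOn_mul (continuous_fourierExp j).continuousOn using 2 with z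
  push_cast
  ring

lemma continuous_exp_mul_chordPow {b : ℝ} (hb : 0 < b) (j : ℤ) :
    Continuous fun z : ℝ => Complex.exp (-Complex.I * j * z) * (chordPow b z : ℂ) :=
  (continuous_fourierExp j).mul (Complex.continuous_ofReal.comp (continuous_chordPow hb))

lemma hasDerivAt_exp_mul_chordPow (b : ℝ) (j : ℤ) {z : ℝ} (hz : 0 < 1 - Real.cos z) :
    HasDerivAt (fun z : ℝ => Complex.exp (-Complex.I * j * z) * (chordPow b z : ℂ))
      (-Complex.I * j * (Complex.exp (-Complex.I * j * z) * (chordPow b z : ℂ)) +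
        2 * b * (Complex.exp (-Complex.I * j * z) * (Real.sin z : ℂ) *
          (chordPow (b - 1) z : ℂ))) z := by
  have h1 : HasDerivAt (fun z : ℝ => Complex.exp (-Complex.I * j * z))
      (Complex.exp (-Complex.I * j * z) * (-Complex.I * j * 1)) z :=
    (((hasDerivAt_id z).ofReal_comp).const_mul (-Complex.I * j)).cexp
  have h : HasDerivAt (fun z : ℝ => Complex.exp (-Complex.I * j * z) * (chordPow b z : ℂ)) _ z :=
    h1.mul (hasDerivAt_chordPow b hz).ofReal_comp
  convert h using 1
  push_cast
  ring

lemma exp_mul_pi_eq_exp_mul_neg_pi (j : ℤ) :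
    Complex.exp (-Complex.I * j * (π : ℝ)) = Complex.exp (-Complex.I * j * ((-π : ℝ) : ℂ)) := by
  rw [Complex.exp_eq_exp_iff_exists_int]
  exact ⟨-j, by push_cast; ring⟩

lemma integral_exp_mul_sin_mul_chordPow {b : ℝ} (hb : 0 < b) (j : ℤ) :
    2 * b * ∫ z in (-π)..π, Complex.exp (-Complex.I * j * z) * (Real.sin z : ℂ) *
      (chordPow (b - 1) z : ℂ) = Complex.I * j * chordFourier b j := by
  have hpi := Real.pi_pos
  have i1 := ((continuous_exp_mul_chordPow hb j).intervalIntegrable (μ := volume) (-π) π).const_mul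
    (-Complex.I * j)
  have i2 := (intervalIntegrable_exp_mul_sin_mul_chordPow hb j).const_mul (2 * b : ℂ)
  have h := integral_eq_of_hasDerivAt_off_countable_of_le _ _ (by linarith : -π ≤ π)
    (Set.countable_singleton (0 : ℝ)) (continuous_exp_mul_chordPow hb j).continuousOn
    (fun z hz => hasDerivAt_exp_mul_chordPow b j (one_sub_cos_pos hz.1 hz.2)) (i1.add i2)
  rw [intervalIntegral.integral_add i1 i2, intervalIntegral.integral_const_mul,
    intervalIntegral.integral_const_mul, chordPow_neg, exp_mul_pi_eq_exp_mul_neg_pi,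
    sub_self] at h
  rw [chordFourier]
  linear_combination h

lemma chordFourier_neg (b : ℝ) (j : ℤ) : chordFourier b (-j) = chordFourier b j := by
  have h := intervalIntegral.integral_comp_neg (a := -π) (b := π)
    fun z : ℝ => Complex.exp (-Complex.I * j * z) * (chordPow b z : ℂ)
  rw [neg_neg] at h
  rw [chordFourier, chordFourier, ← h]
  congr 1
  funext z
  rw [chordPow_neg]
  push_cast
  ring_nf

lemma exp_sub_mul_sin (j : ℤ) (z : ℝ) :
    (Complex.exp (-Complex.I * (j + 1 : ℤ) * z) - Complex.exp (-Complex.I * j * z)) *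
      (Real.sin z : ℂ) =
    -Complex.I * (Complex.exp (-Complex.I * (j + 1 : ℤ) * z) + Complex.exp (-Complex.I * j * z)) *
      (1 - (Real.cos z : ℂ)) := by
  have e : Complex.exp (-Complex.I * (j + 1 : ℤ) * z) =
      Complex.exp (-Complex.I * j * z) * (Complex.cos z - Complex.sin z * Complex.I) := by
    have hz : Complex.exp (-z * Complex.I) = Complex.cos z - Complex.sin z * Complex.I := by
      rw [Complex.exp_mul_I, Complex.cos_neg, Complex.sin_neg]
      ring
    rw [← hz, ← Complex.exp_add]
    push_cast
    ring_nf
  rw [e]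
  push_cast
  have hs := Complex.sin_sq_add_cos_sq (z : ℂ)
  have hI := Complex.I_sq
  linear_combination (-Complex.I * Complex.exp (-Complex.I * j * z)) * hs +
    Complex.exp (-Complex.I * j * z) * Complex.sin z * (Complex.cos z - 1) * hI

lemma chordFourier_succ {b : ℝ} (hb : 0 < b) (j : ℤ) :
    ((j : ℂ) + 1 + b) * chordFourier b (j + 1) = (j - b) * chordFourier b j := by
  have hpi := Real.pi_pos
  have c := continuous_exp_mul_chordPow hb
  have i1 := ((c (j + 1)).intervalIntegrable (μ := volume) (-π) π).const_mul
    (-Complex.I * (j + 1 + b))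
  have i2 := ((c j).intervalIntegrable (μ := volume) (-π) π).const_mul
    (Complex.I * (j - b))
  have h := integral_eq_of_hasDerivAt_off_countable_of_le
    (fun z : ℝ => Complex.exp (-Complex.I * (j + 1 : ℤ) * z) * (chordPow b z : ℂ) -
      Complex.exp (-Complex.I * j * z) * (chordPow b z : ℂ)) _ (by linarith : -π ≤ π)
    (Set.countable_singleton (0 : ℝ)) ((c (j + 1)).sub (c j)).continuousOn
    (fun z hz => by
      have hz' := one_sub_cos_pos hz.1 hz.2
      refine ((hasDerivAt_exp_mul_chordPow b (j + 1) hz').sub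
        (hasDerivAt_exp_mul_chordPow b j hz')).congr_deriv ?_
      have hu : (chordPow b z : ℂ) = 2 * (1 - (Real.cos z : ℂ)) * (chordPow (b - 1) z : ℂ) := by
        rw [chordPow_eq_mul_sub_one hz']
        push_cast
        ring
      have hk := exp_sub_mul_sin j z
      simp only [hu]
      push_cast at hk ⊢
      linear_combination (2 * b * (chordPow (b - 1) z : ℂ)) * hk) (i1.add i2)
  rw [intervalIntegral.integral_add i1 i2, intervalIntegral.integral_const_mul,
    intervalIntegral.integral_const_mul, chordPow_neg, exp_mul_pi_eq_exp_mul_neg_pi,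
    exp_mul_pi_eq_exp_mul_neg_pi, sub_self, ← chordFourier, ← chordFourier] at h
  linear_combination Complex.I * h + (((j : ℂ) + 1 + b) * chordFourier b (j + 1) -
    (j - b) * chordFourier b j) * Complex.I_sq

lemma integral_rpow_mul_one_sub_rpow {p q : ℝ} (hp : 0 < p) (hq : 0 < q) :
    ∫ t in Set.Ioo (0 : ℝ) 1, t ^ (p - 1) * (1 - t) ^ (q - 1) =
      Real.Gamma p * Real.Gamma q / Real.Gamma (p + q) := by
  have h := Complex.betaIntegral_eq_Gamma_mul_div p q (by simpa) (by simpa)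
  rw [← Complex.ofReal_add, Complex.Gamma_ofReal, Complex.Gamma_ofReal, Complex.Gamma_ofReal,
    Complex.betaIntegral, intervalIntegral.integral_of_le zero_le_one,
    integral_Ioc_eq_integral_Ioo] at h
  apply Complex.ofReal_injective
  push_cast
  rw [← h, ← integral_complex_ofReal]
  refine setIntegral_congr_fun measurableSet_Ioo fun t ht => ?_
  simp only [Complex.ofReal_mul]
  rw [Complex.ofReal_cpow ht.1.le, Complex.ofReal_cpow (by linarith [ht.2])]
  push_cast
  rfl

lemma image_half_one_sub_cos :
    (fun z : ℝ => (1 - Real.cos z) / 2) '' Set.Ioo 0 π = Set.Ioo 0 1 := by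
  ext t
  constructor
  · rintro ⟨z, hz, rfl⟩
    have h1 := Real.strictAntiOn_cos ⟨le_rfl, Real.pi_pos.le⟩ ⟨hz.1.le, hz.2.le⟩ hz.1
    have h2 := Real.strictAntiOn_cos ⟨hz.1.le, hz.2.le⟩ ⟨Real.pi_pos.le, le_rfl⟩ hz.2
    rw [Real.cos_zero] at h1
    rw [Real.cos_pi] at h2
    constructor <;> dsimp only <;> linarith
  · intro ht
    refine ⟨Real.arccos (1 - 2 * t), ⟨Real.arccos_pos.2 (by linarith [ht.1]), ?_⟩, ?_⟩
    · refine lt_of_le_of_ne (Real.arccos_le_pi _) fun h => ?_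
      have := Real.arccos_eq_pi.1 h
      linarith [ht.2]
    · dsimp only
      rw [Real.cos_arccos (by linarith [ht.2]) (by linarith [ht.1])]
      ring

lemma integral_chordPow_zero_pi {b : ℝ} (hb : 0 < b) :
    ∫ z in (0 : ℝ)..π, chordPow b z =
      π * Real.Gamma (2 * b + 1) / Real.Gamma (b + 1) ^ 2 := by
  have himg := integral_image_eq_integral_abs_deriv_smul (s := Set.Ioo 0 π)
    (f := fun z : ℝ => (1 - Real.cos z) / 2) (f' := fun z => Real.sin z / 2) measurableSet_Ioo
    (fun z _ => by
      have h := ((Real.hasDerivAt_cos z).const_sub 1).div_const 2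
      rw [neg_neg] at h
      exact h.hasDerivWithinAt)
    (fun x hx y hy hxy => Real.injOn_cos ⟨hx.1.le, hx.2.le⟩ ⟨hy.1.le, hy.2.le⟩ (by
      dsimp only at hxy
      linarith))
    (fun t => t ^ (b + 1 / 2 - 1) * (1 - t) ^ ((1 / 2 : ℝ) - 1))
  rw [image_half_one_sub_cos,
    integral_rpow_mul_one_sub_rpow (by linarith) (by norm_num)] at himg
  have hcongr : ∫ z in (0 : ℝ)..π, chordPow b z = 4 ^ b * ∫ z in Set.Ioo 0 π,
      |Real.sin z / 2| • (((1 - Real.cos z) / 2) ^ (b + 1 / 2 - 1) *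
        (1 - (1 - Real.cos z) / 2) ^ ((1 / 2 : ℝ) - 1)) := by
    rw [intervalIntegral.integral_of_le Real.pi_pos.le, integral_Ioc_eq_integral_Ioo,
      ← integral_const_mul]
    refine setIntegral_congr_fun measurableSet_Ioo fun z hz => ?_
    obtain ⟨h0, h1⟩ : (1 - Real.cos z) / 2 ∈ Set.Ioo (0 : ℝ) 1 :=
      image_half_one_sub_cos ▸ Set.mem_image_of_mem _ hz
    have hs := Real.sin_pos_of_pos_of_lt_pi hz.1 hz.2
    have hsq := Real.sin_sq_add_cos_sq z
    rw [chordPow]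
    have hu : 2 * (1 - Real.cos z) = 4 * ((1 - Real.cos z) / 2) := by ring
    have habs : |Real.sin z / 2| = √(((1 - Real.cos z) / 2) * (1 - (1 - Real.cos z) / 2)) := by
      rw [← Real.sqrt_sq_eq_abs]
      congr 1
      linear_combination hsq / 4
    rw [habs, hu]
    generalize (1 - Real.cos z) / 2 = t at h0 h1
    have h1' : 0 < 1 - t := by linarith
    have e1 : b + 1 / 2 - 1 = b - 1 / 2 := by ring
    have e2 : (1 / 2 : ℝ) - 1 = -(1 / 2) := by norm_num
    rw [Real.mul_rpow (by norm_num) h0.le, Real.sqrt_mul h0.le, e1, e2, Real.rpow_sub h0,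
      Real.rpow_neg h1'.le, ← Real.sqrt_eq_rpow, ← Real.sqrt_eq_rpow, smul_eq_mul]
    have := Real.sqrt_pos.2 h0
    have := Real.sqrt_pos.2 h1'
    field_simp
  have hdup := Real.Gamma_mul_Gamma_add_half (b + 1 / 2)
  have e1 : b + 1 / 2 + 1 / 2 = b + 1 := by ring
  have e2 : 2 * (b + 1 / 2) = 2 * b + 1 := by ring
  have e3 : (4 : ℝ) ^ b * 2 ^ (1 - (2 * b + 1)) = 1 := by
    rw [show (4 : ℝ) = 2 ^ (2 : ℝ) by norm_num, ← Real.rpow_mul (by norm_num),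
      ← Real.rpow_add (by norm_num)]
    ring_nf
    simp
  rw [e1, e2] at hdup
  rw [hcongr, ← himg, e1, Real.Gamma_one_half_eq]
  have hG := Real.Gamma_pos_of_pos (by linarith : 0 < b + 1)
  have hpi := Real.sq_sqrt Real.pi_pos.le
  field_simp
  ring_nf at hdup e3 hpi ⊢
  linear_combination (4 ^ b * √π) * hdup + Real.Gamma (1 + b * 2) * √π ^ 2 * e3 +
    Real.Gamma (1 + b * 2) * hpi

lemma chordFourier_zero {b : ℝ} (hb : 0 < b) :
    chordFourier b 0 = ((2 * π * Real.Gamma (2 * b + 1) / Real.Gamma (b + 1) ^ 2 : ℝ) : ℂ) := by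
  have hc := continuous_chordPow hb
  have h1 : ∫ z in (-π)..0, chordPow b z = ∫ z in (0 : ℝ)..π, chordPow b z := by
    have h := intervalIntegral.integral_comp_neg (a := 0) (b := π) (chordPow b)
    simp only [chordPow_neg, neg_zero] at h
    exact h.symm
  have h2 : ∫ z in (-π)..π, chordPow b z =
      2 * π * Real.Gamma (2 * b + 1) / Real.Gamma (b + 1) ^ 2 := by
    rw [← intervalIntegral.integral_add_adjacent_intervals (hc.intervalIntegrable (-π) 0)
      (hc.intervalIntegrable 0 π), h1, integral_chordPow_zero_pi hb]
    ring
  rw [← h2, ← intervalIntegral.integral_ofReal, chordFourier]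
  simp

lemma Msymb_zero {b : ℝ} (hb : b ∈ Set.Ioo (0 : ℝ) 1) :
    4 * π * b * Msymb (2 - 2 * b) 0 =
      -(2 * π * Real.Gamma (2 * b + 1) / Real.Gamma (b + 1) ^ 2) := by
  have hb0 := hb.1
  have e1 : 2 - (2 - 2 * b) = 2 * b := by ring
  have e2 : 1 - (2 - 2 * b) / 2 = b := by ring
  have e3 : (2 - 2 * b) / 2 = 1 - b := by ring
  rw [Msymb, e1, e2, e3, Real.Gamma_add_one (by positivity), Real.Gamma_add_one hb0.ne']
  have := Real.Gamma_pos_of_pos hb0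
  have := Real.Gamma_pos_of_pos (sub_pos.2 hb.2)
  simp only [Nat.cast_zero, add_zero]
  rw [show (0 : ℝ) ^ 2 - b ^ 2 = -b ^ 2 by ring]
  field_simp
  ring

lemma Msymb_succ {b : ℝ} (hb : b ∈ Set.Ioo (0 : ℝ) 1) (n : ℕ) :
    ((n : ℝ) + 1 + b) * Msymb (2 - 2 * b) (n + 1) = (n - b) * Msymb (2 - 2 * b) n := by
  obtain ⟨hb0, hb1⟩ := hb
  have e2 : 1 - (2 - 2 * b) / 2 = b := by ring
  have e3 : (2 - 2 * b) / 2 = 1 - b := by ring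
  have hn : (0 : ℝ) ≤ n := n.cast_nonneg
  have hnb : (n : ℝ) - b ≠ 0 := by
    rcases n with _ | m
    · simpa using hb0.ne'
    · push_cast
      have : (0 : ℝ) ≤ m := m.cast_nonneg
      linarith
  rw [Msymb, Msymb, e2, e3]
  push_cast
  rw [← add_assoc, ← add_assoc, Real.Gamma_add_one (by linarith : 1 - b + (n : ℝ) ≠ 0),
    Real.Gamma_add_one (by positivity : b + (n : ℝ) ≠ 0)]
  have hG := Real.Gamma_pos_of_pos (by positivity : 0 < b + (n : ℝ))
  have h1 : (n : ℝ) + 1 - b ≠ 0 := by linarith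
  have h2 : (n : ℝ) + 1 + b ≠ 0 := by positivity
  have h3 : (n : ℝ) + b ≠ 0 := by positivity
  have h4 : b + (n : ℝ) ≠ 0 := by positivity
  rw [show ((n : ℝ) + 1) ^ 2 - b ^ 2 = (n + 1 - b) * (n + 1 + b) by ring,
    show (n : ℝ) ^ 2 - b ^ 2 = (n - b) * (n + b) by ring]
  field_simp
  ring

lemma chordFourier_natCast {b : ℝ} (hb : b ∈ Set.Ioo (0 : ℝ) 1) (n : ℕ) :
    chordFourier b n = -((4 * π * b * Msymb (2 - 2 * b) n : ℝ) : ℂ) := by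
  induction n with
  | zero => rw [Msymb_zero hb, Nat.cast_zero, chordFourier_zero hb.1]; push_cast; ring
  | succ n ih =>
    have h := chordFourier_succ hb.1 (n : ℤ)
    have hM : ((n : ℂ) + 1 + b) * (Msymb (2 - 2 * b) (n + 1) : ℂ) =
        (n - b) * (Msymb (2 - 2 * b) n : ℂ) := by exact_mod_cast Msymb_succ hb n
    have hne : (n : ℂ) + 1 + b ≠ 0 := by
      have : (n : ℝ) + 1 + b ≠ 0 := by linarith [hb.1, (n.cast_nonneg : (0 : ℝ) ≤ n)]
      exact_mod_cast this
    apply mul_left_cancel₀ hne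
    rw [ih] at h
    push_cast at h ⊢
    linear_combination h + 4 * π * b * hM

lemma chordFourier_eq {b : ℝ} (hb : b ∈ Set.Ioo (0 : ℝ) 1) (j : ℤ) :
    chordFourier b j = -((4 * π * b * Msymb (2 - 2 * b) j.natAbs : ℝ) : ℂ) := by
  rw [← chordFourier_natCast hb]
  rcases Int.natAbs_eq j with h | h
  · rw [← h]
  · nth_rw 1 [h]
    rw [chordFourier_neg]

/-- Sine-multiplier singular integral formula (Lemma 4.4, Fourier form): for `α ∈ (0,2)`
and `j ∈ ℤ`, `(1/2π)·∫_{−π}^{π} e^{−ijz}·sin z·(2(1 − cos z))^{−α/2} dz = −i·j·M_α(|j|)`,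
the integrand being Lebesgue integrable on `(−π,π)`. -/
theorem sine_multiplier_integral (α : ℝ) (hα : α ∈ Set.Ioo (0 : ℝ) 2) (j : ℤ) :
    IntervalIntegrable
        (fun z : ℝ => Complex.exp (-Complex.I * j * z) * (Real.sin z : ℂ) *
          (((2 * (1 - Real.cos z)) ^ (-(α / 2)) : ℝ) : ℂ))
        volume (-π) π ∧
    (1 / (2 * (π : ℂ))) *
        ∫ z in (-π)..π, Complex.exp (-Complex.I * j * z) * (Real.sin z : ℂ) *
          (((2 * (1 - Real.cos z)) ^ (-(α / 2)) : ℝ) : ℂ)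
      = -Complex.I * (j : ℂ) * ((Msymb α j.natAbs : ℝ) : ℂ) := by
  have hb : 1 - α / 2 ∈ Set.Ioo (0 : ℝ) 1 := ⟨by linarith [hα.2], by linarith [hα.1]⟩
  have e : -(α / 2) = 1 - α / 2 - 1 := by ring
  have hI := integral_exp_mul_sin_mul_chordPow hb.1 j
  rw [chordFourier_eq hb, show 2 - 2 * (1 - α / 2) = α by ring] at hI
  simp only [e]
  refine ⟨intervalIntegrable_exp_mul_sin_mul_chordPow hb.1 j, ?_⟩
  have hb0 : ((1 - α / 2 : ℝ) : ℂ) ≠ 0 := Complex.ofReal_ne_zero.2 hb.1.ne'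
  have hpi : (π : ℂ) ≠ 0 := Complex.ofReal_ne_zero.2 Real.pi_ne_zero
  simp only [chordPow] at hI
  generalize 1 - α / 2 = b at *
  rw [one_div_mul_eq_div, div_eq_iff (mul_ne_zero two_ne_zero hpi)]
  apply mul_left_cancel₀ (mul_ne_zero two_ne_zero hb0)
  rw [hI]
  push_cast
  ring
end

section
/- Absence of three-wave interactions (Lemma 3.4). Let α ∈ (0,2). Then ω_α(2) > 0 and for all nonzero integers n, j, k with k = j + n one has |ω_α(k) − ω_α(j) − ω_α(n)| ≥ ω_α(2). -/
open Real

/-- `c_α := Γ(α/2)/(2^{1−α}·Γ(1−α/2))`. -/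
noncomputable def cAlpha (α : ℝ) : ℝ :=
  Real.Gamma (α / 2) / (2 ^ (1 - α) * Real.Gamma (1 - α / 2))

/-- `T¹_α(n)`. -/
noncomputable def T1 (α : ℝ) (n : ℕ) : ℝ :=
  (Real.Gamma (2 - α) / (Real.Gamma (1 - α / 2) * Real.Gamma (α / 2))) *
    ∑ k ∈ Finset.range n,
      Real.Gamma (α / 2 + k) / ((1 - α / 2 + k) * Real.Gamma (1 - α / 2 + k))

/-- `T²_α(n)`. -/
noncomputable def T2 (α : ℝ) (n : ℕ) : ℝ :=
  (Real.Gamma (2 - α) / (Real.Gamma (1 - α / 2) * Real.Gamma (α / 2))) *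
    (Real.Gamma (α / 2 + n) / Real.Gamma (1 - α / 2 + n))

/-- `L_α(n)`. -/
noncomputable def Lsymb (α : ℝ) (n : ℕ) : ℝ :=
  (cAlpha α / (2 - α)) *
    (T1 α n - T2 α n - Real.Gamma (2 - α) / (Real.Gamma (1 - α / 2)) ^ 2)

/-- Linear frequency `ω_α(j) := j·L_α(|j|)`. -/
noncomputable def omega (α : ℝ) (j : ℤ) : ℝ := (j : ℝ) * Lsymb α j.natAbs

/-- The positive weight whose multiples are the increments of `Lsymb α`. -/
noncomputable def gammaQuotient (α : ℝ) (n : ℕ) : ℝ :=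
  Real.Gamma (α / 2 + n) / Real.Gamma (2 - α / 2 + n)

lemma gammaQuotient_pos {α : ℝ} (hα : α ∈ Set.Ioo (0 : ℝ) 2) (n : ℕ) :
    0 < gammaQuotient α n := by
  obtain ⟨h0, h2⟩ := hα
  have hn : (0 : ℝ) ≤ n := n.cast_nonneg
  exact div_pos (Real.Gamma_pos_of_pos (by linarith)) (Real.Gamma_pos_of_pos (by linarith))

lemma gammaQuotient_succ {α : ℝ} (hα : α ∈ Set.Ioo (0 : ℝ) 2) (n : ℕ) :
    gammaQuotient α (n + 1) * (2 - α / 2 + n) = gammaQuotient α n * (α / 2 + n) := by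
  obtain ⟨h0, h2⟩ := hα
  have hn : (0 : ℝ) ≤ n := n.cast_nonneg
  have hu : (0 : ℝ) < α / 2 + n := by linarith
  have hv : (0 : ℝ) < 2 - α / 2 + n := by linarith
  have hΓ := (Real.Gamma_pos_of_pos hv).ne'
  unfold gammaQuotient
  push_cast
  rw [← add_assoc, ← add_assoc, Real.Gamma_add_one hu.ne', Real.Gamma_add_one hv.ne']
  generalize 2 - α / 2 + (n : ℝ) = v at *
  have := hv.ne'
  field_simp

lemma Lsymb_succ {α : ℝ} (hα : α ∈ Set.Ioo (0 : ℝ) 2) (n : ℕ) :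
    Lsymb α (n + 1) = Lsymb α n + cAlpha α *
      (Real.Gamma (2 - α) / (Real.Gamma (1 - α / 2) * Real.Gamma (α / 2))) *
        gammaQuotient α n := by
  obtain ⟨h0, h2⟩ := hα
  have hn : (0 : ℝ) ≤ n := n.cast_nonneg
  have hu : (0 : ℝ) < α / 2 + n := by linarith
  have hv : (0 : ℝ) < 1 - α / 2 + n := by linarith
  have hΓ := (Real.Gamma_pos_of_pos hv).ne'
  have hv' := hv.ne'
  have h2' : 2 - α ≠ 0 := by linarith
  unfold Lsymb T1 T2 gammaQuotient
  generalize Real.Gamma (2 - α) / (Real.Gamma (1 - α / 2) * Real.Gamma (α / 2)) = K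
  rw [Finset.sum_range_succ]
  push_cast
  rw [← add_assoc, ← add_assoc, Real.Gamma_add_one hu.ne', Real.Gamma_add_one hv.ne',
    show 2 - α / 2 + (n : ℝ) = 1 - α / 2 + n + 1 by ring, Real.Gamma_add_one hv.ne']
  generalize Real.Gamma (1 - α / 2 + n) = B at *
  generalize Real.Gamma (α / 2 + n) = A at *
  generalize hV : 1 - α / 2 + (n : ℝ) = V at *
  have hU : α / 2 + (n : ℝ) = V - 1 + α := by rw [← hV]; ring
  rw [hU]
  field_simp
  ring

lemma Lsymb_one {α : ℝ} (hα : α ∈ Set.Ioo (0 : ℝ) 2) : Lsymb α 1 = 0 := by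
  obtain ⟨h0, h2⟩ := hα
  have hu : (0 : ℝ) < α / 2 := by linarith
  have hv : (0 : ℝ) < 1 - α / 2 := by linarith
  have hA := (Real.Gamma_pos_of_pos hu).ne'
  have hB := (Real.Gamma_pos_of_pos hv).ne'
  have hv' := hv.ne'
  unfold Lsymb T1 T2
  simp only [Finset.sum_range_one, Nat.cast_zero, Nat.cast_one, add_zero]
  rw [Real.Gamma_add_one hu.ne', Real.Gamma_add_one hv.ne']
  generalize Real.Gamma (1 - α / 2) = B at *
  generalize Real.Gamma (α / 2) = A at *
  generalize hV : 1 - α / 2 = V at *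
  rw [show α / 2 = 1 - V by rw [← hV]; ring]
  field_simp
  ring

lemma increment_constant_pos {α : ℝ} (hα : α ∈ Set.Ioo (0 : ℝ) 2) :
    0 < cAlpha α * (Real.Gamma (2 - α) / (Real.Gamma (1 - α / 2) * Real.Gamma (α / 2))) := by
  obtain ⟨h0, h2⟩ := hα
  have hA : 0 < Real.Gamma (α / 2) := Real.Gamma_pos_of_pos (by linarith)
  have hB : 0 < Real.Gamma (1 - α / 2) := Real.Gamma_pos_of_pos (by linarith)
  have hC : 0 < Real.Gamma (2 - α) := Real.Gamma_pos_of_pos (by linarith)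
  unfold cAlpha
  positivity

lemma omega_natCast_convex {α : ℝ} (hα : α ∈ Set.Ioo (0 : ℝ) 2) (m : ℕ) :
    omega α (m + 1 : ℕ) - omega α m ≤ omega α (m + 2 : ℕ) - omega α (m + 1 : ℕ) := by
  have hG := gammaQuotient_succ hα m
  have hpos := gammaQuotient_pos hα m
  have hP := increment_constant_pos hα
  have hL := Lsymb_succ hα m
  have hL' := Lsymb_succ hα (m + 1)
  obtain ⟨h0, h2⟩ := hα
  have hm : (0 : ℝ) ≤ m := m.cast_nonneg
  have key : (m : ℝ) * gammaQuotient α m ≤ (m + 2) * gammaQuotient α (m + 1) := by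
    have hv : (0 : ℝ) < 2 - α / 2 + m := by linarith
    refine le_of_mul_le_mul_right ?_ hv
    rw [mul_assoc ((m : ℝ) + 2), hG]
    have : 0 ≤ gammaQuotient α m * (α * (1 + m)) := by positivity
    linarith
  have := mul_le_mul_of_nonneg_left key hP.le
  simp only [omega, Int.natAbs_natCast, Int.cast_natCast]
  push_cast
  rw [show m + 2 = m + 1 + 1 from rfl, hL', hL]
  linarith

lemma omega_one {α : ℝ} (hα : α ∈ Set.Ioo (0 : ℝ) 2) : omega α 1 = 0 := by
  simp [omega, Lsymb_one hα]

lemma omega_two_pos {α : ℝ} (hα : α ∈ Set.Ioo (0 : ℝ) 2) : 0 < omega α 2 := by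
  have h := Lsymb_succ hα 1
  rw [Lsymb_one hα, zero_add] at h
  have : 0 < Lsymb α 2 := h ▸ mul_pos (increment_constant_pos hα) (gammaQuotient_pos hα 1)
  simpa [omega] using this

lemma omega_neg (α : ℝ) (j : ℤ) : omega α (-j) = -omega α j := by
  simp [omega]

/-- A sequence with monotone increments has a monotone superadditivity defect. -/
lemma defect_le_of_increments_monotone {f : ℕ → ℝ} (hf : Monotone fun m => f (m + 1) - f m)
    (i j : ℕ) : f 2 - f 1 - f 1 ≤ f (i + 1 + (j + 1)) - f (i + 1) - f (j + 1) := by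
  have step (p q : ℕ) : f (1 + (q + 1)) - f 1 ≤ f (p + 1 + (q + 1)) - f (p + 1) := by
    induction p with
    | zero => simp
    | succ p ih =>
      have h := hf (show p + 1 ≤ p + 1 + (q + 1) by omega)
      simp only at h
      rw [show p + 1 + 1 + (q + 1) = p + 1 + (q + 1) + 1 by omega]
      linarith
  have h := step i j
  have h' := hf (show 1 ≤ j + 1 by omega)
  simp only at h'
  rw [show 1 + (j + 1) = j + 1 + 1 by omega] at h
  norm_num at h' h ⊢
  linarith

lemma omega_two_le_of_pos {α : ℝ} (hα : α ∈ Set.Ioo (0 : ℝ) 2) {j n : ℤ} (hj : 0 < j)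
    (hn : 0 < n) : omega α 2 ≤ omega α (j + n) - omega α j - omega α n := by
  obtain ⟨p, rfl⟩ : ∃ p : ℕ, j = (p + 1 : ℕ) := ⟨(j - 1).toNat, by omega⟩
  obtain ⟨q, rfl⟩ : ∃ q : ℕ, n = (q + 1 : ℕ) := ⟨(n - 1).toNat, by omega⟩
  have h := defect_le_of_increments_monotone (f := fun m => omega α m)
    (monotone_nat_of_le_succ (omega_natCast_convex hα)) p q
  have h1 := omega_one hα
  push_cast at h ⊢
  linarith

/-- Absence of three-wave interactions (Lemma 3.4): `ω_α(2) > 0` and for all nonzero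
integers `n, j, k` with `k = j + n` one has `|ω_α(k) − ω_α(j) − ω_α(n)| ≥ ω_α(2)`. -/
theorem no_three_wave_interactions (α : ℝ) (hα : α ∈ Set.Ioo (0 : ℝ) 2) :
    0 < omega α 2 ∧
    ∀ n j k : ℤ, n ≠ 0 → j ≠ 0 → k ≠ 0 → k = j + n →
      omega α 2 ≤ |omega α k - omega α j - omega α n| := by
  refine ⟨omega_two_pos hα, fun n j k hn hj hk hkjn => ?_⟩
  have main {a b c : ℤ} (ha : 0 < a) (hb : 0 < b) (hc : c = a + b) :
      omega α 2 ≤ omega α c - omega α a - omega α b := hc ▸ omega_two_le_of_pos hα ha hb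
  have hn' := omega_neg α n
  have hj' := omega_neg α j
  have hk' := omega_neg α k
  rw [le_abs]
  rcases hn.lt_or_gt with hn0 | hn0 <;> rcases hj.lt_or_gt with hj0 | hj0
  · have := main (neg_pos.2 hj0) (neg_pos.2 hn0) (show -k = -j + -n by omega)
    right; linarith
  · rcases hk.lt_or_gt with hk0 | hk0
    · have := main (neg_pos.2 hk0) hj0 (show -n = -k + j by omega)
      left; linarith
    · have := main hk0 (neg_pos.2 hn0) (show j = k + -n by omega)
      right; linarith
  · rcases hk.lt_or_gt with hk0 | hk0
    · have := main (neg_pos.2 hk0) hn0 (show -j = -k + n by omega)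
      left; linarith
    · have := main hk0 (neg_pos.2 hj0) (show n = k + -j by omega)
      right; linarith
  · have := main hj0 hn0 hkjn
    left; linarith
end

section
/- Oscillatory sine-power integral (equation (3.15) in the proof of Lemma 3.1). Let α ∈ (0,2) and let k ≥ 0 be an integer. Then the complex-valued function z ↦ e^{−i(2k+1)z}·(sin z)^{1−α} is Lebesgue integrable on (0,π) and ∫_0^{π} e^{−i(2k+1)z}·(sin z)^{1−α} dz = (−i·π·2^{α−1})·( Γ(2−α)/(Γ(1−α/2)·Γ(α/2)) )·Γ(α/2+k)/Γ(2−α/2+k), where Γ denotes the real Gamma function. -/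
open Real MeasureTheory

/-- The substitution `x = (1 - cos z) / 2` turns the symmetric Beta integrand into a power of
`sin z / 2`. -/
lemma abs_sin_div_two_smul_betaIntegrand (s : ℝ) {z : ℝ} (hz : z ∈ Set.Ioo 0 π) :
    |sin z / 2| • ((((1 - cos z) / 2 : ℝ) : ℂ) ^ ((((s + 1) / 2 : ℝ) : ℂ) - 1) *
      (1 - (((1 - cos z) / 2 : ℝ) : ℂ)) ^ ((((s + 1) / 2 : ℝ) : ℂ) - 1)) =
      (((1 / 2) ^ s * sin z ^ s : ℝ) : ℂ) := by
  have hs : 0 < sin z := sin_pos_of_mem_Ioo hz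
  have hsq := sin_sq_add_cos_sq z
  have h1 : 0 < (1 - cos z) / 2 := by nlinarith [neg_one_le_cos z, cos_le_one z]
  have h2 : 0 < 1 - (1 - cos z) / 2 := by nlinarith [neg_one_le_cos z, cos_le_one z]
  rw [abs_of_pos (by positivity), Complex.real_smul, ← Complex.ofReal_one, ← Complex.ofReal_sub,
    ← Complex.ofReal_sub, ← Complex.ofReal_cpow h1.le, ← Complex.ofReal_cpow h2.le,
    ← Complex.ofReal_mul, ← Complex.ofReal_mul, ← mul_rpow h1.le h2.le,
    ← mul_rpow (by norm_num) hs.le]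
  congr 1
  have h3 : (1 - cos z) / 2 * (1 - (1 - cos z) / 2) = (sin z / 2) ^ (2 : ℝ) := by
    rw [rpow_two]; linarith
  rw [h3, ← rpow_mul (by positivity)]
  nth_rewrite 1 [← rpow_one (sin z / 2)]
  rw [← rpow_add (by positivity)]
  congr 1 <;> ring

lemma image_one_sub_cos_div_two :
    (fun z : ℝ => (1 - cos z) / 2) '' Set.Ioo 0 π = Set.Ioo 0 1 := by
  ext x
  constructor
  · rintro ⟨z, hz, rfl⟩
    have := sin_pos_of_mem_Ioo hz
    constructor <;> nlinarith [neg_one_le_cos z, cos_le_one z, sin_sq_add_cos_sq z]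
  · rintro ⟨h0, h1⟩
    refine ⟨arccos (1 - 2 * x), ⟨arccos_pos.2 (by linarith), ?_⟩, ?_⟩
    · exact lt_of_le_of_ne (arccos_le_pi _) fun h => by
        rw [arccos_eq_pi] at h; linarith
    · simp only
      rw [cos_arccos (by linarith) (by linarith)]
      ring

lemma injOn_one_sub_cos_div_two :
    Set.InjOn (fun z : ℝ => (1 - cos z) / 2) (Set.Ioo 0 π) := fun x hx y hy h =>
  injOn_cos (Set.Ioo_subset_Icc_self hx) (Set.Ioo_subset_Icc_self hy) (by
    simp only at h; linarith)

lemma hasDerivAt_one_sub_cos_div_two (z : ℝ) :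
    HasDerivAt (fun z : ℝ => (1 - cos z) / 2) (sin z / 2) z := by
  simpa using ((hasDerivAt_cos z).const_sub 1).div_const 2

lemma intervalIntegrable_sin_rpow {s : ℝ} (hs : -1 < s) :
    IntervalIntegrable (fun z : ℝ => sin z ^ s) volume 0 π := by
  have hu : 0 < Complex.re (((s + 1) / 2 : ℝ) : ℂ) := by
    rw [Complex.ofReal_re]; linarith
  have h := Complex.betaIntegral_convergent hu hu
  rw [intervalIntegrable_iff_integrableOn_Ioo_of_le zero_le_one, ← image_one_sub_cos_div_two,
    integrableOn_image_iff_integrableOn_abs_deriv_smul measurableSet_Ioo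
      (fun z _ => (hasDerivAt_one_sub_cos_div_two z).hasDerivWithinAt)
      injOn_one_sub_cos_div_two,
    integrableOn_congr_fun (fun z hz => abs_sin_div_two_smul_betaIntegrand s hz)
      measurableSet_Ioo] at h
  rw [intervalIntegrable_iff_integrableOn_Ioo_of_le pi_pos.le]
  have hc : ((1 / 2 : ℝ) ^ s) ≠ 0 := by positivity
  refine (h.re.const_mul ((1 / 2 : ℝ) ^ s)⁻¹).congr (ae_of_all _ fun z => ?_)
  simp only [RCLike.re_to_complex, Complex.ofReal_re]
  rw [inv_mul_cancel_left₀ hc]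

lemma integral_sin_rpow {s : ℝ} (hs : -1 < s) :
    ∫ z in (0 : ℝ)..π, sin z ^ s = √π * Real.Gamma ((s + 1) / 2) / Real.Gamma (s / 2 + 1) := by
  have hu : 0 < Complex.re (((s + 1) / 2 : ℝ) : ℂ) := by
    rw [Complex.ofReal_re]; linarith
  have h := Complex.betaIntegral_eq_Gamma_mul_div _ _ hu hu
  rw [Complex.betaIntegral, intervalIntegral.integral_of_le zero_le_one,
    integral_Ioc_eq_integral_Ioo, ← image_one_sub_cos_div_two,
    integral_image_eq_integral_abs_deriv_smul measurableSet_Ioo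
      (fun z _ => (hasDerivAt_one_sub_cos_div_two z).hasDerivWithinAt)
      injOn_one_sub_cos_div_two,
    setIntegral_congr_fun measurableSet_Ioo
      (fun z hz => abs_sin_div_two_smul_betaIntegrand s hz), integral_complex_ofReal,
    ← Complex.ofReal_add, Complex.Gamma_ofReal, Complex.Gamma_ofReal, ← Complex.ofReal_mul,
    ← Complex.ofReal_div, Complex.ofReal_inj, integral_const_mul,
    ← integral_Ioc_eq_integral_Ioo, ← intervalIntegral.integral_of_le pi_pos.le] at h
  have hd := Real.Gamma_mul_Gamma_add_half ((s + 1) / 2)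
  have e1 : (s + 1) / 2 + 1 / 2 = s / 2 + 1 := by ring
  have e2 : 2 * ((s + 1) / 2) = s + 1 := by ring
  have e3 : 1 - (s + 1) = -s := by ring
  have e4 : (s + 1) / 2 + (s + 1) / 2 = s + 1 := by ring
  rw [e1, e2, e3, rpow_neg zero_le_two] at hd
  rw [e4, one_div, inv_rpow zero_le_two] at h
  have g1 : 0 < Real.Gamma (s / 2 + 1) := Real.Gamma_pos_of_pos (by linarith)
  have g2 : 0 < Real.Gamma (s + 1) := Real.Gamma_pos_of_pos (by linarith)
  have p : (0 : ℝ) < 2 ^ s := by positivity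
  generalize Real.Gamma (s / 2 + 1) = A at *
  generalize Real.Gamma ((s + 1) / 2) = B at *
  generalize Real.Gamma (s + 1) = C at *
  field_simp at h hd ⊢
  refine mul_left_cancel₀ g2.ne' ?_
  linear_combination A * h + B * hd

lemma intervalIntegrable_cexp_mul_sin_rpow {s : ℝ} (hs : -1 < s) (m : ℂ) :
    IntervalIntegrable (fun z : ℝ => Complex.exp (-Complex.I * m * z) * ((sin z ^ s : ℝ) : ℂ))
      volume 0 π :=
  IntervalIntegrable.continuousOn_mul
    (show IntervalIntegrable (fun z : ℝ => ((sin z ^ s : ℝ) : ℂ)) volume 0 π from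
      ⟨(intervalIntegrable_sin_rpow hs).1.ofReal, (intervalIntegrable_sin_rpow hs).2.ofReal⟩)
    (by fun_prop)

/-- Integrating the derivative of `exp (-i m z) * sin z ^ (s + 1)` relates the Fourier-type
integrals of `sin z ^ s` at frequencies `m - 1` and `m + 1`. -/
lemma integral_cexp_mul_sin_rpow_recurrence {s : ℝ} (hs : -1 < s) (m : ℂ) :
    (s + 1 - m) *
        (∫ z in (0 : ℝ)..π, Complex.exp (-Complex.I * (m - 1) * z) * ((sin z ^ s : ℝ) : ℂ)) +
      (s + 1 + m) *
        (∫ z in (0 : ℝ)..π, Complex.exp (-Complex.I * (m + 1) * z) * ((sin z ^ s : ℝ) : ℂ)) =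
      0 := by
  have i1 := (intervalIntegrable_cexp_mul_sin_rpow hs (m - 1)).const_mul ((s + 1 - m) / 2)
  have i2 := (intervalIntegrable_cexp_mul_sin_rpow hs (m + 1)).const_mul ((s + 1 + m) / 2)
  have h := intervalIntegral.integral_eq_sub_of_hasDerivAt_of_le pi_pos.le
    (f := fun z : ℝ => Complex.exp (-Complex.I * m * z) * ((sin z ^ (s + 1) : ℝ) : ℂ))
    (by
      refine Continuous.continuousOn ?_
      have : Continuous fun z : ℝ => sin z ^ (s + 1) :=
        continuous_sin.rpow_const fun _ => Or.inr (by linarith)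
      fun_prop)
    (fun z hz => ?_) (i1.add i2)
  · rw [intervalIntegral.integral_add i1 i2, intervalIntegral.integral_const_mul,
      intervalIntegral.integral_const_mul] at h
    simp only [sin_pi, sin_zero, zero_rpow (by linarith : s + 1 ≠ 0), Complex.ofReal_zero,
      mul_zero, sub_zero] at h
    linear_combination 2 * h
  · have hz' : 0 < sin z := sin_pos_of_mem_Ioo hz
    have d1 : HasDerivAt (fun z : ℝ => Complex.exp (-Complex.I * m * z))
        (Complex.exp (-Complex.I * m * z) * (-Complex.I * m)) z := by
      simpa using ((hasDerivAt_id z).ofReal_comp.const_mul (-Complex.I * m)).cexp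
    have d2 := ((hasDerivAt_sin z).rpow_const (p := s + 1) (Or.inl hz'.ne')).ofReal_comp
    refine (d1.mul d2).congr_deriv ?_
    have e1 : Complex.exp (-Complex.I * (m - 1) * z) =
        Complex.exp (-Complex.I * m * z) * (Complex.cos z + Complex.sin z * Complex.I) := by
      rw [← Complex.exp_mul_I, ← Complex.exp_add]; ring_nf
    have e2 : Complex.exp (-Complex.I * (m + 1) * z) =
        Complex.exp (-Complex.I * m * z) * (Complex.cos z - Complex.sin z * Complex.I) := by
      have e : Complex.cos z - Complex.sin z * Complex.I = Complex.exp (-z * Complex.I) := by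
        rw [Complex.exp_mul_I, Complex.cos_neg, Complex.sin_neg]; ring
      rw [e, ← Complex.exp_add]; ring_nf
    rw [e1, e2, add_sub_cancel_right, rpow_add hz', rpow_one]
    push_cast
    ring

lemma integral_cexp_neg_I_mul_sin_rpow {s : ℝ} (hs : -1 < s) :
    ∫ z in (0 : ℝ)..π, Complex.exp (-Complex.I * 1 * z) * ((sin z ^ s : ℝ) : ℂ) =
      -Complex.I * ((∫ z in (0 : ℝ)..π, sin z ^ (s + 1) : ℝ) : ℂ) := by
  have h := integral_cexp_mul_sin_rpow_recurrence hs 0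
  have hs0 : (s : ℂ) + 1 ≠ 0 := by
    norm_cast; linarith
  rw [sub_zero, add_zero, ← mul_add, mul_eq_zero, or_iff_right hs0, zero_sub, zero_add] at h
  have hd : (∫ z in (0 : ℝ)..π, Complex.exp (-Complex.I * -1 * z) * ((sin z ^ s : ℝ) : ℂ)) -
      (∫ z in (0 : ℝ)..π, Complex.exp (-Complex.I * 1 * z) * ((sin z ^ s : ℝ) : ℂ)) =
      2 * Complex.I * ((∫ z in (0 : ℝ)..π, sin z ^ (s + 1) : ℝ) : ℂ) := by
    rw [← intervalIntegral.integral_sub (intervalIntegrable_cexp_mul_sin_rpow hs _)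
      (intervalIntegrable_cexp_mul_sin_rpow hs _), ← intervalIntegral.integral_ofReal,
      ← intervalIntegral.integral_const_mul]
    refine intervalIntegral.integral_congr_uIoo fun z hz => ?_
    rw [Set.uIoo_of_le pi_pos.le] at hz
    have e1 : -Complex.I * -1 * z = z * Complex.I := by ring
    have e2 : -Complex.I * 1 * z = -z * Complex.I := by ring
    simp only [e1, e2]
    rw [rpow_add (sin_pos_of_mem_Ioo hz), rpow_one, Complex.exp_mul_I, Complex.exp_mul_I,
      Complex.cos_neg, Complex.sin_neg]
    push_cast
    ring
  linear_combination (h - hd) / 2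

/-- Oscillatory sine-power integral (equation (3.15) in the proof of Lemma 3.1):
for `α ∈ (0,2)` and every integer `k ≥ 0`,
`∫_0^π e^{−i(2k+1)z}·(sin z)^{1−α} dz
  = (−iπ·2^{α−1})·(Γ(2−α)/(Γ(1−α/2)Γ(α/2)))·Γ(α/2+k)/Γ(2−α/2+k)`,
the integrand being Lebesgue integrable on `(0,π)`. -/
theorem oscillatory_sine_power_integral (α : ℝ) (hα : α ∈ Set.Ioo (0 : ℝ) 2) (k : ℕ) :
    IntervalIntegrable
        (fun z : ℝ => Complex.exp (-Complex.I * (2 * k + 1) * z) *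
          ((Real.sin z ^ (1 - α) : ℝ) : ℂ))
        volume 0 π ∧
    ∫ z in (0 : ℝ)..π, Complex.exp (-Complex.I * (2 * k + 1) * z) *
        ((Real.sin z ^ (1 - α) : ℝ) : ℂ)
      = -Complex.I * (π : ℂ) * (((2 : ℝ) ^ (α - 1) : ℝ) : ℂ) *
          ((Real.Gamma (2 - α) / (Real.Gamma (1 - α / 2) * Real.Gamma (α / 2)) : ℝ) : ℂ) *
          ((Real.Gamma (α / 2 + k) / Real.Gamma (2 - α / 2 + k) : ℝ) : ℂ) := by
  obtain ⟨h0, h2⟩ := hα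
  have hs : -1 < 1 - α := by linarith
  refine ⟨intervalIntegrable_cexp_mul_sin_rpow hs _, ?_⟩
  have g1 : 0 < Real.Gamma (1 - α / 2) := Real.Gamma_pos_of_pos (by linarith)
  have g2 : 0 < Real.Gamma (α / 2) := Real.Gamma_pos_of_pos (by linarith)
  induction k with
  | zero =>
    have h := integral_cexp_neg_I_mul_sin_rpow hs
    have g3 : 0 < Real.Gamma (2 - α / 2) := Real.Gamma_pos_of_pos (by linarith)
    have hd := Real.Gamma_mul_Gamma_add_half (1 - α / 2)
    rw [integral_sin_rpow (by linarith)] at h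
    have e1 : (1 - α + 1 + 1) / 2 = 1 - α / 2 + 1 / 2 := by ring
    have e2 : (1 - α + 1) / 2 + 1 = 2 - α / 2 := by ring
    have e3 : 2 * (1 - α / 2) = 2 - α := by ring
    have e4 : 1 - (2 - α) = α - 1 := by ring
    rw [e3, e4] at hd
    rw [e1, e2] at h
    simp only [Nat.cast_zero, mul_zero, zero_add, add_zero]
    rw [h]
    have hp : √π * √π = π := mul_self_sqrt pi_pos.le
    have key : √π * Real.Gamma (1 - α / 2 + 1 / 2) / Real.Gamma (2 - α / 2) =
        π * 2 ^ (α - 1) * (Real.Gamma (2 - α) / (Real.Gamma (1 - α / 2) * Real.Gamma (α / 2))) *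
          (Real.Gamma (α / 2) / Real.Gamma (2 - α / 2)) := by
      generalize Real.Gamma (1 - α / 2 + 1 / 2) = A at *
      generalize Real.Gamma (2 - α / 2) = B at *
      generalize Real.Gamma (1 - α / 2) = C at *
      generalize Real.Gamma (2 - α) = D at *
      generalize Real.Gamma (α / 2) = E at *
      field_simp
      linear_combination √π * hd + D * 2 ^ (α - 1) * hp
    rw [key]
    push_cast
    ring
  | succ k ih =>
    have h := integral_cexp_mul_sin_rpow_recurrence hs (2 * k + 2)
    have g3 : 0 < Real.Gamma (2 - α / 2 + k) :=
      Real.Gamma_pos_of_pos (by have := k.cast_nonneg (α := ℝ); linarith)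
    have hk : (0 : ℝ) < 2 - α / 2 + k := by have := k.cast_nonneg (α := ℝ); linarith
    have hk' : (0 : ℝ) < α / 2 + k := by positivity
    have e1 : (2 * k + 2 - 1 : ℂ) = 2 * k + 1 := by ring
    have e2 : (2 * k + 2 + 1 : ℂ) = 2 * (k + 1 : ℕ) + 1 := by push_cast; ring
    rw [e1, e2, ih] at h
    have e3 : α / 2 + (k + 1 : ℕ) = α / 2 + k + 1 := by push_cast; ring
    have e4 : 2 - α / 2 + (k + 1 : ℕ) = 2 - α / 2 + k + 1 := by push_cast; ring
    rw [e3, e4, Real.Gamma_add_one hk.ne', Real.Gamma_add_one hk'.ne', mul_div_mul_comm]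
    have hc : ((2 - α / 2 + k : ℝ) : ℂ) ≠ 0 := Complex.ofReal_ne_zero.2 hk.ne'
    rw [Complex.ofReal_mul, Complex.ofReal_div (α / 2 + k) (2 - α / 2 + k)]
    refine mul_left_cancel₀ hc ?_
    rw [mul_left_comm, ← mul_assoc _ (_ / _), mul_div_cancel₀ _ hc]
    have e5 : ((2 - α / 2 + k : ℝ) : ℂ) = 2 - α / 2 + k := by push_cast; ring
    have e6 : ((α / 2 + k : ℝ) : ℂ) = α / 2 + k := by push_cast; ring
    have e7 : ((1 - α : ℝ) : ℂ) = 1 - α := by push_cast; ring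
    rw [e7] at h
    rw [e5, e6]
    linear_combination h / 2
end
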